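/- Let G be a loopless weighted graph (q_e ≠ 0 for every edge e), let T : Φ_{G,Q} → (Finset E → K) be the K-algebra homomorphism determined by u_e ↦ (E' ↦ q_e if e ∈ E', else 0), and for a subset I ⊆ Fin n let f_I = ∏_{e ∈ E(I,Ī)} u_e · ∏_{e ∈ E(Ī,I)} (u_e − q_e) ∈ Φ_{G,Q}. Then T(f_I) is the function sending E' ⊆ E to (∏_{e ∈ E(I,Ī)} q_e) · (∏_{e ∈ E(Ī,I)} (−q_e)) if E' ∩ C(I) = E(I,Ī), and to 0 otherwise, where C(I) = E(I,Ī) ∪ E(Ī,I). In particular, T(f_I) is supported exactly on the subsets E' whose associated orientation directs every edge of the cut C(I) out of I. -/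

import Mathlib

open MvPolynomial

set_option synthInstance.maxHeartbeats 1000000
set_option maxHeartbeats 1000000

noncomputable section

/-- The ideal of relations `u_e ^ 2 = q_e * u_e`. -/
def relIdeal (K : Type*) [Field K] (E : Type*) (q : E → K) :
    Ideal (MvPolynomial E K) :=
  Ideal.span (Set.range fun e : E => (X e) ^ 2 - C (q e) * X e)

/-- The algebra `Φ_{G,Q}`. -/
abbrev PhiAlg (K : Type*) [Field K] (E : Type*) (q : E → K) : Type _ :=
  MvPolynomial E K ⧸ relIdeal K E q

/-- The generator `X_i` of the `Q`-deformation. -/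
def XX (K : Type*) [Field K] {n : ℕ} {E : Type*} [Fintype E]
    (a b : E → Fin n) (q : E → K) (i : Fin n) : PhiAlg K E q :=
  Ideal.Quotient.mk _
    ((∑ e ∈ Finset.univ.filter fun e => a e = i, X e) -
      ∑ e ∈ Finset.univ.filter fun e => b e = i, X e)

/-- The `Q`-deformation `Ψ_{G,Q}` of the Postnikov–Shapiro algebra. -/
def PsiAlg (K : Type*) [Field K] {n : ℕ} {E : Type*} [Fintype E]
    (a b : E → Fin n) (q : E → K) : Subalgebra K (PhiAlg K E q) :=
  Algebra.adjoin K (Set.range (XX K a b q))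

/-- The edges of the cut oriented out of `I` (small endpoint in `I`). -/
def cutOut {n : ℕ} {E : Type*} [Fintype E] (a b : E → Fin n) (I : Finset (Fin n)) :
    Finset E :=
  Finset.univ.filter fun e => a e ∈ I ∧ b e ∉ I

/-- The edges of the cut oriented into `I` (large endpoint in `I`). -/
def cutIn {n : ℕ} {E : Type*} [Fintype E] (a b : E → Fin n) (I : Finset (Fin n)) :
    Finset E :=
  Finset.univ.filter fun e => b e ∈ I ∧ a e ∉ I

/-- The cut polynomial `f_I`. -/
def fI {K : Type*} [Field K] {n : ℕ} {E : Type*} [Fintype E]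
    (a b : E → Fin n) (q : E → K) (I : Finset (Fin n)) : MvPolynomial E K :=
  (∏ e ∈ cutOut a b I, X e) * ∏ e ∈ cutIn a b I, (X e - C (q e))

/-- The function on subsets of edges associated to the generator `u_e`. -/
def edgeFun {K : Type*} [Field K] {E : Type*} [DecidableEq E] (q : E → K) (e : E) :
    Finset E → K := fun E' => if e ∈ E' then q e else 0

/-- Under the homomorphism `T : Φ_{G,Q} → (Finset E → K)`, the cut element
`f_I` is sent to the function supported exactly on the subsets `E'` whose orientation directs
every edge of the cut `C(I)` out of `I`, with value `(∏_{E(I,Ī)} q_e)·(∏_{E(Ī,I)} (-q_e))`. -/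
theorem T_fI_eq
    {K : Type*} [Field K] [CharZero K] {n : ℕ} {E : Type*} [Fintype E] [DecidableEq E]
    (a b : E → Fin n) (q : E → K) (hab : ∀ e, a e < b e) (hq : ∀ e, q e ≠ 0)
    (T : PhiAlg K E q →ₐ[K] (Finset E → K))
    (hT : ∀ e : E, T (Ideal.Quotient.mk (relIdeal K E q) (X e)) = edgeFun q e)
    (I : Finset (Fin n)) (E' : Finset E) :
    T (Ideal.Quotient.mk (relIdeal K E q) (fI a b q I)) E' =
      if E' ∩ (cutOut a b I ∪ cutIn a b I) = cutOut a b I then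
        (∏ e ∈ cutOut a b I, q e) * ∏ e ∈ cutIn a b I, (-(q e))
      else 0 := by
  have hC : ∀ c : K, T (Ideal.Quotient.mk (relIdeal K E q) (C c)) = fun _ => c := by
    intro c
    have h := T.commutes c
    exact h
  have key : T (Ideal.Quotient.mk (relIdeal K E q) (fI a b q I)) E' =
      (∏ e ∈ cutOut a b I, if e ∈ E' then q e else 0) *
        ∏ e ∈ cutIn a b I, ((if e ∈ E' then q e else 0) - q e) := by
    simp only [fI, map_mul, map_prod, map_sub, hT, hC, Pi.mul_apply, Finset.prod_apply,
      Pi.sub_apply, edgeFun]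
  rw [key]
  have hdisj : ∀ e, e ∈ cutOut a b I → e ∉ cutIn a b I := by
    intro e h1 h2
    simp only [cutOut, cutIn, Finset.mem_filter] at h1 h2
    exact h2.2.2 h1.2.1
  split_ifs with h
  · congr 1
    · refine Finset.prod_congr rfl fun e he => ?_
      have : e ∈ E' := by
        rw [← h] at he
        exact (Finset.mem_inter.1 he).1
      rw [if_pos this]
    · refine Finset.prod_congr rfl fun e he => ?_
      have : e ∉ E' := by
        intro hE
        refine hdisj e ?_ he
        rw [← h]
        exact Finset.mem_inter.2 ⟨hE, Finset.mem_union_right _ he⟩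
      rw [if_neg this, zero_sub]
  · by_contra hne
    apply h
    have h1 := Finset.prod_ne_zero_iff.1 (left_ne_zero_of_mul hne)
    have h2 := Finset.prod_ne_zero_iff.1 (right_ne_zero_of_mul hne)
    ext e
    rw [Finset.mem_inter, Finset.mem_union]
    constructor
    · rintro ⟨hE, ho | hi⟩
      · exact ho
      · exact absurd (by rw [if_pos hE, sub_self]) (h2 e hi)
    · intro ho
      refine ⟨?_, Or.inl ho⟩
      by_contra hE
      exact h1 e ho (if_neg hE)

end
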